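/- Let μ ⊢ n, let l be maximal such that μ_l > 0, and write μ̃ = (μ_1,…,μ_{l−1}) ⊢ n − μ_l. Then T_{w_μ} y_{μ′} ∈ Γ_0(T_{w_{μ̃}} y_{μ̃′}) H_n, where T_{w_{μ̃}} y_{μ̃′} is computed in H_{n−μ_l} and Γ_0 : H_{n−μ_l} → H_n is the standard embedding T_i ↦ T_i; that is, T_{w_μ} y_{μ′} = Γ_0(T_{w_{μ̃}} y_{μ̃′}) · h for some h ∈ H_n. -/

import Mathlib

open scoped Classical

noncomputable section

namespace FayersSemistd

/-- The value at `q` of the Gaussian (quantum) binomial coefficient polynomial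
`[a choose b]`, defined via the `q`-Pascal recurrence. -/
def qBinom {F : Type*} [Field F] (q : F) : ℕ → ℕ → F
  | _, 0 => 1
  | 0, _+1 => 0
  | a+1, b+1 => qBinom q a b + q ^ (b+1) * qBinom q a (b+1)

/-- `∏_i [A_i + B_i choose A_i]_q`, where `A_i`, `B_i` are multiplicities in the
multisets `A` and `B`. -/
def qBinomProd {F : Type*} [Field F] (q : F) (A B : Multiset ℕ) : F :=
  ∏ i ∈ (A + B).toFinset, qBinom q ((A + B).count i) (A.count i)

/-- `∑_{i<j} A_j * B_i` : the number of pairs `(x,y)` with `x ∈ A`, `y ∈ B`, `y < x`,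
counted with multiplicity. -/
def invPairs (A B : Multiset ℕ) : ℕ :=
  ((A.product B).filter (fun p => p.2 < p.1)).card

/-- The Coxeter length of a permutation of `{0,…,n-1}`: its number of inversions. -/
def permLength {n : ℕ} (w : Equiv.Perm (Fin n)) : ℕ :=
  (Finset.univ.filter (fun p : Fin n × Fin n => p.1 < p.2 ∧ w p.2 < w p.1)).card

/-- `λ_0 + ⋯ + λ_{r-1}`. -/
def cumSum (lam : ℕ → ℕ) (r : ℕ) : ℕ := ∑ i ∈ Finset.range r, lam i

/-- The (0-indexed) row of the diagram of `λ` containing the (0-indexed) position `p`,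
when positions are listed row by row. -/
def rowOf (lam : ℕ → ℕ) (p : ℕ) : ℕ := sInf {r | p < cumSum lam (r+1)}

/-- `λ` is a composition of `n`: finitely many nonzero parts, summing to `n`. -/
def IsComposition (n : ℕ) (lam : ℕ → ℕ) : Prop :=
  ∃ N, (∀ r, N ≤ r → lam r = 0) ∧ cumSum lam N = n

/-- `μ` is a partition of `n`. -/
def IsPartition (n : ℕ) (mu : ℕ → ℕ) : Prop := IsComposition n mu ∧ Antitone mu

/-- The conjugate partition (0-indexed): `conjP μ i = #{r | μ r > i}`. -/
def conjP (mu : ℕ → ℕ) (i : ℕ) : ℕ := sInf {r | mu r ≤ i}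

/-- The standard Young subgroup `W_λ` of `S_n` (as a set): the permutations preserving
each consecutive block of sizes `λ_0, λ_1, …`. -/
def youngW {n : ℕ} (lam : ℕ → ℕ) : Set (Equiv.Perm (Fin n)) :=
  {w | ∀ p : Fin n, rowOf lam ((w p : Fin n) : ℕ) = rowOf lam (p : ℕ)}

/-- The adjacent transposition `(i, i+1)` (0-indexed) in `S_n`. -/
def adjT {n : ℕ} (i : ℕ) (h : i + 1 < n) : Equiv.Perm (Fin n) :=
  Equiv.swap ⟨i, Nat.lt_of_succ_lt h⟩ ⟨i+1, h⟩

/-- `T : S_n → H` is the standard basis of an Iwahori–Hecke algebra of `S_n` over `F`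
with parameter `q`.  Permutations act on the right, so the product `w·s` of the paper
is `s * w` in Mathlib's convention; the multiplication rule
`T_w T_s = T_{ws}` (length increasing) resp. `T_w T_s = q T_{ws} + (q-1) T_w`
(length decreasing) determines the algebra structure on the basis. -/
structure IsHeckeBasis {F : Type*} [Field F] {H : Type*} [Ring H] [Algebra F H] {n : ℕ}
    (q : F) (T : Equiv.Perm (Fin n) → H) : Prop where
  li : LinearIndependent F T
  total : Submodule.span F (Set.range T) = ⊤
  one : T 1 = 1
  mul_adj_asc : ∀ (w : Equiv.Perm (Fin n)) (i : ℕ) (h : i + 1 < n),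
    permLength w < permLength (adjT i h * w) →
    T w * T (adjT i h) = T (adjT i h * w)
  mul_adj_desc : ∀ (w : Equiv.Perm (Fin n)) (i : ℕ) (h : i + 1 < n),
    permLength (adjT i h * w) < permLength w →
    T w * T (adjT i h) = q • T (adjT i h * w) + (q - 1) • T w

variable {F : Type*} [Field F] {H : Type*} [Ring H] [Algebra F H] {n : ℕ}

/-- `x_λ = ∑_{w ∈ W_λ} T_w`. -/
def xElt (T : Equiv.Perm (Fin n) → H) (lam : ℕ → ℕ) : H :=
  ∑ w ∈ Finset.univ.filter (· ∈ youngW lam), T w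

/-- `y_λ = ∑_{w ∈ W_λ} (-q)^{-l(w)} T_w`. -/
def yElt (q : F) (T : Equiv.Perm (Fin n) → H) (lam : ℕ → ℕ) : H :=
  ∑ w ∈ Finset.univ.filter (· ∈ youngW lam), ((-q)⁻¹) ^ permLength w • T w

/-- The double coset `W_λ d W_μ` (paper convention: maps act on the right, so the
paper product `u·d·v` is `v * d * u` in Mathlib's convention). -/
def doubleCoset {n : ℕ} (lam mu : ℕ → ℕ) (d : Equiv.Perm (Fin n)) :
    Set (Equiv.Perm (Fin n)) :=
  {w | ∃ u ∈ youngW (n := n) lam, ∃ v ∈ youngW (n := n) mu, w = v * d * u}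

/-- `∑_{w ∈ W_λ 1_A W_μ} T_w`, the image `x_μ φ_A` of `x_μ` under the tableau
homomorphism `φ_A : M^μ → M^λ`, where `d = 1_A`. -/
def XPhi (T : Equiv.Perm (Fin n) → H) (lam mu : ℕ → ℕ) (d : Equiv.Perm (Fin n)) : H :=
  ∑ w ∈ Finset.univ.filter (· ∈ doubleCoset lam mu d), T w

/-- A row-standard tableau is recorded by the multisets of entries of its rows; it has
shape `μ` when row `r` has `μ_r` entries. -/
def RowsOfShape (mu : ℕ → ℕ) (A : ℕ → Multiset ℕ) : Prop := ∀ r, (A r).card = mu r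

/-- The tableau with rows `A 0, A 1, …` has type `λ` when the entry `v` occurs `λ_v`
times in total (entries and types are 0-indexed). -/
def HasType (A : ℕ → Multiset ℕ) (lam : ℕ → ℕ) : Prop :=
  ∀ v, (∑ᶠ r, (A r).count v) = lam v

/-- The entry in row `r`, column `c` (0-indexed) of the row-standard tableau with row
multisets `A`. -/
def entryAt (A : ℕ → Multiset ℕ) (r c : ℕ) : ℕ := ((A r).sort (· ≤ ·)).getD c 0

/-- `d = 1_A` for the row-standard `μ`-tableau `A` of type `λ`: the tableau `t^λ d`
(whose entry at position `p` is `d p`) is row-standard (first clause), and the entry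
`d p` lies in row `r` of `t^λ d` exactly when the position occupied by `d p` in `t^μ`
is occupied by `r` in `A` (second clause). -/
def Is1A {n : ℕ} (mu lam : ℕ → ℕ) (A : ℕ → Multiset ℕ) (d : Equiv.Perm (Fin n)) : Prop :=
  (∀ p p' : Fin n, rowOf lam (p : ℕ) = rowOf lam (p' : ℕ) → p < p' → d p < d p') ∧
  (∀ p : Fin n,
    entryAt A (rowOf mu ((d p : Fin n) : ℕ))
      (((d p : Fin n) : ℕ) - cumSum mu (rowOf mu ((d p : Fin n) : ℕ)))
      = rowOf lam (p : ℕ))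

/-- A row-standard tableau is semistandard if its columns are strictly increasing. -/
def Semistandard (mu : ℕ → ℕ) (A : ℕ → Multiset ℕ) : Prop :=
  ∀ r c, c < mu (r+1) → entryAt A r c < entryAt A (r+1) c

/-- The (0-indexed) column of the position `p` in the diagram of `μ`. -/
def colIdx (mu : ℕ → ℕ) (p : ℕ) : ℕ := p - cumSum mu (rowOf mu p)

/-- `w = w_μ`, i.e. `t^μ w = t_μ`: the image of position `p` is the number of positions
coming strictly before `p` in the column-reading order of the diagram of `μ`. -/
def IsWmu {n : ℕ} (mu : ℕ → ℕ) (w : Equiv.Perm (Fin n)) : Prop :=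
  ∀ p : Fin n, ((w p : Fin n) : ℕ) = (Finset.univ.filter (fun p' : Fin n =>
    colIdx mu (p' : ℕ) < colIdx mu (p : ℕ) ∨
      (colIdx mu (p' : ℕ) = colIdx mu (p : ℕ) ∧ rowOf mu (p' : ℕ) < rowOf mu (p : ℕ)))).card

def comp1 (a : ℕ) : ℕ → ℕ := fun r => if r = 0 then a else 0
def comp2 (a b : ℕ) : ℕ → ℕ := fun r => if r = 0 then a else if r = 1 then b else 0
def comp3 (a b c : ℕ) : ℕ → ℕ :=
  fun r => if r = 0 then a else if r = 1 then b else if r = 2 then c else 0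
def comp4 (a b c d : ℕ) : ℕ → ℕ :=
  fun r => if r = 0 then a else if r = 1 then b else if r = 2 then c else if r = 3 then d else 0
def rows1 (a : Multiset ℕ) : ℕ → Multiset ℕ := fun r => if r = 0 then a else 0
def rows2 (a b : Multiset ℕ) : ℕ → Multiset ℕ :=
  fun r => if r = 0 then a else if r = 1 then b else 0
def rows3 (a b c : Multiset ℕ) : ℕ → Multiset ℕ :=
  fun r => if r = 0 then a else if r = 1 then b else if r = 2 then c else 0
def rows4 (a b c d : Multiset ℕ) : ℕ → Multiset ℕ :=
  fun r => if r = 0 then a else if r = 1 then b else if r = 2 then c else if r = 3 then d else 0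

end FayersSemistd
namespace FayersSemistd

section Length

variable {n : ℕ}

lemma permLength_mul (a b : Equiv.Perm (Fin n))
    (h : ∀ i j, i < j → a j < a i → b (a j) < b (a i)) :
    permLength (b * a) = permLength a + permLength b := by
  unfold permLength
  rw [← Finset.card_map (s := Finset.univ.filter
    (fun p : Fin n × Fin n => p.1 < p.2 ∧ b p.2 < b p.1))
    (Equiv.prodCongr a.symm a.symm).toEmbedding, ← Finset.card_union_of_disjoint]
  · congr 1
    ext ⟨i, j⟩
    simp only [Finset.mem_filter, Finset.mem_univ, true_and, Finset.mem_union,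
      Finset.mem_map_equiv, Equiv.prodCongr_symm, Equiv.symm_symm, Equiv.prodCongr_apply,
      Prod.map_apply]
    simp only [Equiv.Perm.mul_apply]
    constructor
    · rintro ⟨hij, hb⟩
      rcases lt_trichotomy (a i) (a j) with hlt | heq | hgt
      · exact Or.inr ⟨hlt, hb⟩
      · exact absurd (a.injective heq) hij.ne
      · exact Or.inl ⟨hij, hgt⟩
    · rintro (⟨hij, ha⟩ | ⟨ha, hb⟩)
      · exact ⟨hij, h i j hij ha⟩
      · refine ⟨?_, hb⟩
        by_contra hij
        have hne : j ≠ i := fun e => by simp [e] at ha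
        exact absurd (h j i (lt_of_le_of_ne (not_lt.1 hij) hne) ha) (not_lt.2 hb.le)
  · rw [Finset.disjoint_left]
    rintro ⟨i, j⟩ h1 h2
    simp only [Finset.mem_filter, Finset.mem_univ, true_and,
      Finset.mem_map_equiv, Equiv.prodCongr_symm, Equiv.symm_symm, Equiv.prodCongr_apply,
      Prod.map_apply] at h1 h2
    exact absurd h1.2 (not_lt.2 h2.1.le)

lemma permLength_one : permLength (1 : Equiv.Perm (Fin n)) = 0 := by
  unfold permLength
  rw [Finset.card_eq_zero, Finset.filter_eq_empty_iff]
  rintro ⟨i, j⟩ - ⟨h1, h2⟩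
  exact absurd h1 (not_lt.2 h2.le)

lemma adjT_mul_self (k : ℕ) (hk : k + 1 < n) : adjT k hk * adjT k hk = 1 :=
  Equiv.swap_mul_self _ _

lemma adjT_apply_left (k : ℕ) (hk : k + 1 < n) :
    adjT k hk ⟨k, Nat.lt_of_succ_lt hk⟩ = ⟨k + 1, hk⟩ := Equiv.swap_apply_left _ _

lemma adjT_apply_right (k : ℕ) (hk : k + 1 < n) :
    adjT k hk ⟨k + 1, hk⟩ = ⟨k, Nat.lt_of_succ_lt hk⟩ := Equiv.swap_apply_right _ _

/-- The only pair that the adjacent transposition inverts is the pair that it exchanges. -/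
lemma adjT_inversion {k : ℕ} (hk : k + 1 < n) {x y : Fin n} (hxy : x < y)
    (h : adjT k hk y < adjT k hk x) : x = ⟨k, Nat.lt_of_succ_lt hk⟩ ∧ y = ⟨k + 1, hk⟩ := by
  unfold adjT at h
  simp only [Equiv.swap_apply_def] at h
  simp only [Fin.ext_iff, Fin.lt_def] at *
  split_ifs at h <;> simp_all <;> omega

lemma permLength_adjT_pos (k : ℕ) (hk : k + 1 < n) : 0 < permLength (adjT k hk) := by
  unfold permLength
  refine Finset.card_pos.2 ⟨(⟨k, Nat.lt_of_succ_lt hk⟩, ⟨k + 1, hk⟩), ?_⟩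
  simp [adjT_apply_left, adjT_apply_right]

lemma permLength_lt_adjT_mul {w : Equiv.Perm (Fin n)} {k : ℕ} (hk : k + 1 < n)
    (h : w.symm ⟨k, Nat.lt_of_succ_lt hk⟩ < w.symm ⟨k + 1, hk⟩) :
    permLength w < permLength (adjT k hk * w) := by
  rw [permLength_mul]
  · exact Nat.lt_add_of_pos_right (permLength_adjT_pos k hk)
  · intro i j hij hw
    by_contra hs
    have hs' : adjT k hk (w i) < adjT k hk (w j) :=
      lt_of_le_of_ne (not_lt.1 hs) fun e => hij.ne (w.injective ((adjT k hk).injective e))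
    obtain ⟨h1, h2⟩ := adjT_inversion hk hw hs'
    rw [← h1, ← h2, Equiv.symm_apply_apply, Equiv.symm_apply_apply] at h
    exact absurd h (not_lt.2 hij.le)

lemma exists_descent {w : Equiv.Perm (Fin n)} (hw : w ≠ 1) :
    ∃ (k : ℕ) (hk : k + 1 < n),
      w.symm ⟨k + 1, hk⟩ < w.symm ⟨k, Nat.lt_of_succ_lt hk⟩ := by
  by_contra! hcon
  apply hw
  have hmono : StrictMono w.symm := by
    cases n with
    | zero => exact fun i => i.elim0
    | succ m =>
      refine Fin.strictMono_iff_lt_succ.2 fun i => lt_of_le_of_ne (hcon i i.succ.isLt) ?_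
      intro e
      simpa [Fin.ext_iff] using w.symm.injective e
  have : w.symm = 1 := by
    ext x
    have := (StrictMono.range_inj hmono strictMono_id).1 (by simp)
    simp [this]
  rw [← w.symm_symm, this]
  rfl

/-- Induction along left multiplications by adjacent transpositions that increase the length. -/
lemma perm_adjT_induction {P : Equiv.Perm (Fin n) → Prop} (one : P 1)
    (step : ∀ (w : Equiv.Perm (Fin n)) (k : ℕ) (hk : k + 1 < n),
      w.symm ⟨k, Nat.lt_of_succ_lt hk⟩ < w.symm ⟨k + 1, hk⟩ → P w → P (adjT k hk * w))
    (w : Equiv.Perm (Fin n)) : P w := by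
  induction hl : permLength w using Nat.strong_induction_on generalizing w with
  | _ l ih =>
    by_cases hw : w = 1
    · rwa [hw]
    · obtain ⟨k, hk, hd⟩ := exists_descent hw
      have hs : (adjT k hk).symm = adjT k hk := Equiv.symm_swap _ _
      have hasc : (adjT k hk * w).symm ⟨k, Nat.lt_of_succ_lt hk⟩
          < (adjT k hk * w).symm ⟨k + 1, hk⟩ := by
        change w.symm ((adjT k hk).symm _) < w.symm ((adjT k hk).symm _)
        rwa [hs, adjT_apply_left, adjT_apply_right]
      have hback : adjT k hk * (adjT k hk * w) = w := by
        rw [← mul_assoc, adjT_mul_self, one_mul]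
      have hlt := permLength_lt_adjT_mul hk hasc
      rw [hback] at hlt
      have := step _ k hk hasc (ih _ (hl ▸ hlt) _ rfl)
      rwa [hback] at this

lemma eq_one_of_permLength_eq_zero {w : Equiv.Perm (Fin n)} (h : permLength w = 0) : w = 1 := by
  induction w using perm_adjT_induction with
  | one => rfl
  | step w k hk hw _ =>
    exact absurd h (Nat.ne_of_gt (Nat.zero_lt_of_lt (permLength_lt_adjT_mul hk hw)))

end Length

section Hecke

variable {F : Type*} [Field F] {H : Type*} [Ring H] [Algebra F H] {n : ℕ} {q : F}

lemma IsHeckeBasis.mul_adjT {T : Equiv.Perm (Fin n) → H} (hT : IsHeckeBasis q T)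
    {w : Equiv.Perm (Fin n)} {k : ℕ} (hk : k + 1 < n)
    (h : w.symm ⟨k, Nat.lt_of_succ_lt hk⟩ < w.symm ⟨k + 1, hk⟩) :
    T w * T (adjT k hk) = T (adjT k hk * w) :=
  hT.mul_adj_asc w k hk (permLength_lt_adjT_mul hk h)

lemma IsHeckeBasis.mul_of_inversions {T : Equiv.Perm (Fin n) → H} (hT : IsHeckeBasis q T)
    (a b : Equiv.Perm (Fin n)) (h : ∀ i j, i < j → a j < a i → b (a j) < b (a i)) :
    T a * T b = T (b * a) := by
  induction b using perm_adjT_induction with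
  | one => rw [hT.one, mul_one, one_mul]
  | step b k hk hb ih =>
    have hab : ∀ i j, i < j → a j < a i → b (a j) < b (a i) := by
      intro i j hij ha
      by_contra hcon
      have hlt : b (a i) < b (a j) :=
        lt_of_le_of_ne (not_lt.1 hcon) fun e => hij.ne (a.injective (b.injective e))
      obtain ⟨h1, h2⟩ := adjT_inversion hk hlt (h i j hij ha)
      rw [← h1, ← h2, Equiv.symm_apply_apply, Equiv.symm_apply_apply] at hb
      exact absurd hb (not_lt.2 ha.le)
    rw [← hT.mul_adjT hk hb, ← mul_assoc, ih hab, hT.mul_adjT hk, mul_assoc]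
    change a.symm (b.symm _) < a.symm (b.symm _)
    by_contra hcon
    have hne : a.symm (b.symm ⟨k + 1, hk⟩) ≠ a.symm (b.symm ⟨k, Nat.lt_of_succ_lt hk⟩) :=
      fun e => hb.ne' (a.symm.injective e)
    have := h _ _ (lt_of_le_of_ne (not_lt.1 hcon) hne) (by simpa using hb)
    simp [adjT_apply_left, adjT_apply_right] at this

end Hecke

section Embedding

variable {m n : ℕ}

/-- The standard embedding of symmetric groups. -/
def permCastLE (h : m ≤ n) : Equiv.Perm (Fin m) →* Equiv.Perm (Fin n) :=
  Equiv.Perm.viaEmbeddingHom (Fin.castLEEmb h)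

lemma permCastLE_castLE (h : m ≤ n) (u : Equiv.Perm (Fin m)) (x : Fin m) :
    permCastLE h u (Fin.castLE h x) = Fin.castLE h (u x) :=
  Equiv.Perm.viaEmbedding_apply u (Fin.castLEEmb h) x

lemma permCastLE_of_le (h : m ≤ n) (u : Equiv.Perm (Fin m)) {x : Fin n} (hx : m ≤ x) :
    permCastLE h u x = x := by
  refine Equiv.Perm.viaEmbedding_apply_of_notMem u (Fin.castLEEmb h) x ?_
  rintro ⟨y, rfl⟩
  exact absurd y.isLt (not_lt.2 hx)

lemma exists_castLE_or_le (h : m ≤ n) (x : Fin n) : (∃ y, x = Fin.castLE h y) ∨ m ≤ x := by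
  rcases lt_or_ge (x : ℕ) m with hx | hx
  · exact Or.inl ⟨⟨x, hx⟩, rfl⟩
  · exact Or.inr hx

/-- Every inversion of the extension of `u` is an inversion of `u`. -/
lemma permCastLE_inversion (h : m ≤ n) (u : Equiv.Perm (Fin m)) {i j : Fin n} (hij : i < j)
    (hu : permCastLE h u j < permCastLE h u i) :
    ∃ a b : Fin m, i = Fin.castLE h a ∧ j = Fin.castLE h b ∧ a < b ∧ u b < u a := by
  rcases exists_castLE_or_le h i with ⟨a, rfl⟩ | hi <;>
    rcases exists_castLE_or_le h j with ⟨b, rfl⟩ | hj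
  · rw [permCastLE_castLE, permCastLE_castLE] at hu
    exact ⟨a, b, rfl, rfl, hij, hu⟩
  · rw [permCastLE_castLE, permCastLE_of_le h u hj] at hu
    have := (u a).isLt
    simp only [Fin.lt_def, Fin.val_castLE] at hu
    omega
  · have := b.isLt
    simp only [Fin.lt_def, Fin.val_castLE] at hij
    omega
  · rw [permCastLE_of_le h u hi, permCastLE_of_le h u hj] at hu
    exact absurd hu (not_lt.2 hij.le)

lemma permLength_permCastLE (h : m ≤ n) (u : Equiv.Perm (Fin m)) :
    permLength (permCastLE h u) = permLength u := by
  unfold permLength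
  rw [← Finset.card_map (s := Finset.univ.filter
    (fun p : Fin m × Fin m => p.1 < p.2 ∧ u p.2 < u p.1))
    ((Fin.castLEEmb h).prodMap (Fin.castLEEmb h))]
  congr 1
  ext ⟨i, j⟩
  simp only [Finset.mem_filter, Finset.mem_univ, true_and, Finset.mem_map, Prod.exists]
  constructor
  · rintro ⟨hij, hu⟩
    obtain ⟨a, b, rfl, rfl, hab, hu'⟩ := permCastLE_inversion h u hij hu
    exact ⟨a, b, ⟨hab, hu'⟩, rfl⟩
  · rintro ⟨a, b, ⟨hab, hu⟩, e⟩
    obtain ⟨rfl, rfl⟩ := Prod.ext_iff.1 e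
    refine ⟨hab, ?_⟩
    change permCastLE h u (Fin.castLE h b) < permCastLE h u (Fin.castLE h a)
    rwa [permCastLE_castLE, permCastLE_castLE]

lemma permCastLE_adjT (h : m ≤ n) (k : ℕ) (hk : k + 1 < m) :
    permCastLE h (adjT k hk) = adjT k (hk.trans_le h) := by
  ext x
  congr 1
  rcases exists_castLE_or_le h x with ⟨y, rfl⟩ | hx
  · rw [permCastLE_castLE, adjT, adjT, Equiv.swap_apply_def, Equiv.swap_apply_def]
    simp only [Fin.ext_iff, Fin.val_castLE]
    split_ifs <;> rfl
  · rw [permCastLE_of_le h _ hx, adjT, Equiv.swap_apply_of_ne_of_ne] <;>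
    · simp only [ne_eq, Fin.ext_iff]
      omega

variable {F : Type*} [Field F] {H : Type*} [Ring H] [Algebra F H]
  {H' : Type*} [Ring H'] [Algebra F H'] {q : F}

lemma map_heckeBasis (h : m ≤ n) {T : Equiv.Perm (Fin n) → H} (hT : IsHeckeBasis q T)
    {T' : Equiv.Perm (Fin m) → H'} (hT' : IsHeckeBasis q T') (g : H' →ₐ[F] H)
    (hg : ∀ (i : ℕ) (hi : i + 1 < m), g (T' (adjT i hi)) = T (adjT i (hi.trans_le h)))
    (u : Equiv.Perm (Fin m)) : g (T' u) = T (permCastLE h u) := by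
  induction u using perm_adjT_induction with
  | one => rw [hT'.one, map_one, map_one, hT.one]
  | step u k hk hu ih =>
    rw [← hT'.mul_adjT hk hu, map_mul, map_mul, ih, hg k hk, permCastLE_adjT]
    refine hT.mul_adj_asc _ _ _ ?_
    rw [← permCastLE_adjT h k hk, ← map_mul, permLength_permCastLE, permLength_permCastLE]
    exact permLength_lt_adjT_mul hk hu

end Embedding

section Cosets

variable {m n : ℕ}

/-- `e` is increasing on the level sets of `β`. -/
def IncrOnBlocks (h : m ≤ n) (β : Fin m → ℕ) (e : Equiv.Perm (Fin n)) : Prop :=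
  ∀ i j : Fin m, β i = β j → i < j → e (Fin.castLE h i) < e (Fin.castLE h j)

lemma IncrOnBlocks.inversions {h : m ≤ n} {β : Fin m → ℕ} (hβ : Monotone β)
    {e : Equiv.Perm (Fin n)} (he : IncrOnBlocks h β e) {u : Equiv.Perm (Fin m)}
    (hu : ∀ p, β (u p) = β p) (i j : Fin n) (hij : i < j)
    (hinv : permCastLE h u j < permCastLE h u i) :
    e (permCastLE h u j) < e (permCastLE h u i) := by
  obtain ⟨a, b, rfl, rfl, hab, hlt⟩ := permCastLE_inversion h u hij hinv
  rw [permCastLE_castLE, permCastLE_castLE]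
  refine he _ _ (le_antisymm (hβ hlt.le) ?_) hlt
  rw [hu, hu]
  exact hβ hab.le

lemma IncrOnBlocks.permLength_mul {h : m ≤ n} {β : Fin m → ℕ} (hβ : Monotone β)
    {e : Equiv.Perm (Fin n)} (he : IncrOnBlocks h β e) {u : Equiv.Perm (Fin m)}
    (hu : ∀ p, β (u p) = β p) :
    permLength (e * permCastLE h u) = permLength u + permLength e := by
  rw [FayersSemistd.permLength_mul _ _ (he.inversions hβ hu), permLength_permCastLE]

lemma exists_incrOnBlocks (h : m ≤ n) {β : Fin m → ℕ} (hβ : Monotone β)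
    (z : Equiv.Perm (Fin n)) :
    ∃ u : Equiv.Perm (Fin m), (∀ p, β (u p) = β p) ∧
      IncrOnBlocks h β (z * permCastLE h u) := by
  obtain ⟨u, hu, hmin⟩ := Set.exists_min_image {u : Equiv.Perm (Fin m) | ∀ p, β (u p) = β p}
    (fun u => permLength (z * permCastLE h u)) (Set.toFinite _) ⟨1, fun _ => rfl⟩
  refine ⟨u, hu, ?_⟩
  have hadj : ∀ (k : ℕ) (hk : k + 1 < m),
      β ⟨k, Nat.lt_of_succ_lt hk⟩ = β ⟨k + 1, hk⟩ →
      (z * permCastLE h u) (Fin.castLE h ⟨k, Nat.lt_of_succ_lt hk⟩)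
        < (z * permCastLE h u) (Fin.castLE h ⟨k + 1, hk⟩) := by
    intro k hk hb
    by_contra hcon
    have hlt : (z * permCastLE h u) (Fin.castLE h ⟨k + 1, hk⟩)
        < (z * permCastLE h u) (Fin.castLE h ⟨k, Nat.lt_of_succ_lt hk⟩) := by
      refine lt_of_le_of_ne (not_lt.1 hcon) fun e => ?_
      simpa [Fin.ext_iff] using (z * permCastLE h u).injective e
    have hmem : ∀ p, β ((u * adjT k hk) p) = β p := by
      intro p
      rw [Equiv.Perm.mul_apply, hu]
      unfold adjT
      rw [Equiv.swap_apply_def]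
      split_ifs with h1 h2
      · rw [h1, hb]
      · rw [h2, hb]
      · rfl
    have hle := hmin _ hmem
    have hs := adjT_mul_self k (hk.trans_le h)
    have heq := permLength_mul (adjT k (hk.trans_le h))
      (z * permCastLE h (u * adjT k hk)) (by
        intro i j hij hinv
        obtain ⟨rfl, rfl⟩ := adjT_inversion _ hij hinv
        rw [← Equiv.Perm.mul_apply, ← Equiv.Perm.mul_apply, map_mul, permCastLE_adjT,
          mul_assoc, mul_assoc, hs, mul_one]
        exact hlt)
    rw [map_mul, permCastLE_adjT, mul_assoc, mul_assoc, hs, mul_one] at heq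
    have hpos := permLength_adjT_pos k (hk.trans_le h)
    simp only [map_mul, permCastLE_adjT] at hle
    omega
  rintro ⟨i, hi⟩ ⟨j, hj⟩ hb hij
  have hij' : i + 1 ≤ j := hij
  clear hij
  induction j, hij' using Nat.le_induction with
  | base => exact hadj i hj hb
  | succ j hle ih =>
    have hj' : j < m := Nat.lt_of_succ_lt hj
    have h1 : β ⟨i, hi⟩ ≤ β ⟨j, hj'⟩ := hβ (Fin.mk_le_mk.2 (by omega))
    have h2 : β ⟨j, hj'⟩ ≤ β ⟨j + 1, hj⟩ := hβ (Fin.mk_le_mk.2 (by omega))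
    exact (ih hj' (by omega)).trans (hadj j hj (by omega))

/-- Summation over a union of left cosets of a Young subgroup, through the coset
representatives that are increasing on blocks. -/
lemma sum_eq_sum_incrOnBlocks {M : Type*} [AddCommMonoid M] (h : m ≤ n) {β : Fin m → ℕ}
    (hβ : Monotone β) (X : Finset (Equiv.Perm (Fin n)))
    (hX : ∀ z ∈ X, ∀ u : Equiv.Perm (Fin m), (∀ p, β (u p) = β p) → z * permCastLE h u ∈ X)
    (f : Equiv.Perm (Fin n) → M) :
    ∑ z ∈ X, f z = ∑ e ∈ X.filter (IncrOnBlocks h β),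
      ∑ u ∈ Finset.univ.filter (fun u : Equiv.Perm (Fin m) => ∀ p, β (u p) = β p),
        f (e * permCastLE h u) := by
  rw [← Finset.sum_product']
  symm
  have hinv : ∀ u : Equiv.Perm (Fin m), (∀ p, β (u p) = β p) → ∀ p, β (u⁻¹ p) = β p := by
    intro u hu p
    rw [← hu (u⁻¹ p)]
    exact congrArg β (u.apply_symm_apply p)
  refine Finset.sum_bij (fun x _ => x.1 * permCastLE h x.2) ?_ ?_ ?_ (fun _ _ => rfl)
  · rintro ⟨e, u⟩ hx
    simp only [Finset.mem_product, Finset.mem_filter, Finset.mem_univ, true_and] at hx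
    exact hX e hx.1.1 u hx.2
  · rintro ⟨e, u⟩ hx ⟨e', u'⟩ hx' heq
    simp only [Finset.mem_product, Finset.mem_filter, Finset.mem_univ, true_and] at hx hx' heq
    have h1 : e' * permCastLE h (u' * u⁻¹) = e := by
      rw [map_mul, ← mul_assoc, ← heq, mul_assoc, ← map_mul, mul_inv_cancel, map_one, mul_one]
    have h2 : e * permCastLE h (u * u'⁻¹) = e' := by
      rw [map_mul, ← mul_assoc, heq, mul_assoc, ← map_mul, mul_inv_cancel, map_one, mul_one]
    have l1 := hx'.1.2.permLength_mul hβ (u := u' * u⁻¹) fun p => by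
      rw [Equiv.Perm.mul_apply, hx'.2, hinv u hx.2]
    have l2 := hx.1.2.permLength_mul hβ (u := u * u'⁻¹) fun p => by
      rw [Equiv.Perm.mul_apply, hx.2, hinv u' hx'.2]
    rw [h1] at l1
    rw [h2] at l2
    have hu : u * u'⁻¹ = 1 := eq_one_of_permLength_eq_zero (by omega)
    rw [hu, map_one, mul_one] at h2
    rw [h2, mul_inv_eq_one.1 hu]
  · intro z hz
    obtain ⟨u, hu, he⟩ := exists_incrOnBlocks h hβ z
    refine ⟨(z * permCastLE h u, u⁻¹), ?_, ?_⟩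
    · simp only [Finset.mem_product, Finset.mem_filter, Finset.mem_univ, true_and]
      exact ⟨⟨hX z hz u hu, he⟩, hinv u hu⟩
    · simp only
      rw [mul_assoc, ← map_mul, mul_inv_cancel, map_one, mul_one]

variable {F : Type*} [Field F] {H : Type*} [Ring H] [Algebra F H]
  {H' : Type*} [Ring H'] [Algebra F H'] {q : F}

lemma exists_factor_of_blocks (c : F) (h : m ≤ n)
    {T : Equiv.Perm (Fin n) → H} (hT : IsHeckeBasis q T)
    {T' : Equiv.Perm (Fin m) → H'} (hT' : IsHeckeBasis q T') (g : H' →ₐ[F] H)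
    (hg : ∀ (i : ℕ) (hi : i + 1 < m), g (T' (adjT i hi)) = T (adjT i (hi.trans_le h)))
    {β : Fin n → ℕ} (hβ : Monotone β) {β' : Fin m → ℕ} (hβ' : Monotone β')
    (w : Equiv.Perm (Fin n)) (w' : Equiv.Perm (Fin m))
    (hww : ∀ a b, w' a < w' b → w (Fin.castLE h a) < w (Fin.castLE h b))
    (hw : ∀ i j, i < j → w j < w i → β (w j) < β (w i))
    (hββ : ∀ a, β (w (Fin.castLE h a)) = β' (w' a)) :
    ∃ r : H, T w * ∑ x ∈ Finset.univ.filter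
        (fun x : Equiv.Perm (Fin n) => ∀ p, β (x p) = β p), c ^ permLength x • T x
      = g (T' w' * ∑ u ∈ Finset.univ.filter
        (fun u : Equiv.Perm (Fin m) => ∀ p, β' (u p) = β' p), c ^ permLength u • T' u) * r := by
  set d : Equiv.Perm (Fin n) := w * (permCastLE h w')⁻¹ with hd
  have hdw : d * permCastLE h w' = w := by rw [hd, inv_mul_cancel_right]
  have hdw_apply : ∀ a, d (permCastLE h w' a) = w a := fun a =>
    congrArg (fun v : Equiv.Perm (Fin n) => v a) hdw
  have hdcond : ∀ i j, i < j → permCastLE h w' j < permCastLE h w' i →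
      d (permCastLE h w' j) < d (permCastLE h w' i) := by
    intro i j hij hinv
    rw [hdw_apply, hdw_apply]
    obtain ⟨a, b, rfl, rfl, -, hlt⟩ := permCastLE_inversion h w' hij hinv
    exact hww _ _ hlt
  have hTw : T w = g (T' w') * T d := by
    rw [map_heckeBasis h hT hT' g hg, hT.mul_of_inversions _ _ hdcond, hdw]
  have hxd : ∀ x : Equiv.Perm (Fin n), (∀ p, β (x p) = β p) →
      ∀ i j, i < j → d j < d i → x (d j) < x (d i) := by
    intro x hx i j hij hdij
    obtain ⟨a, rfl⟩ := (permCastLE h w').surjective i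
    obtain ⟨b, rfl⟩ := (permCastLE h w').surjective j
    have hab : a < b := by
      by_contra hcon
      have hne : b ≠ a := fun e => by simp [e] at hij
      exact absurd (hdcond b a (lt_of_le_of_ne (not_lt.1 hcon) hne) hij) (not_lt.2 hdij.le)
    rw [hdw_apply, hdw_apply] at *
    by_contra hcon
    have hle := hβ (not_lt.1 hcon)
    rw [hx, hx] at hle
    exact absurd (hw a b hab hdij) (not_lt.2 hle)
  have hβd : ∀ a : Fin m, β (d (Fin.castLE h a)) = β' a := by
    intro a
    obtain ⟨b, rfl⟩ := w'.surjective a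
    rw [← permCastLE_castLE, hdw_apply, hββ]
  have hβdu : ∀ u : Equiv.Perm (Fin m), (∀ p, β' (u p) = β' p) → ∀ p,
      β (d (permCastLE h u p)) = β (d p) := by
    intro u hu p
    rcases exists_castLE_or_le h p with ⟨a, rfl⟩ | hp
    · rw [permCastLE_castLE, hβd, hβd, hu]
    · rw [permCastLE_of_le h u hp]
  set X : Finset (Equiv.Perm (Fin n)) :=
    Finset.univ.filter (fun z => ∀ p, β ((z * d⁻¹) p) = β p) with hXdef
  have hX : ∀ z ∈ X, ∀ u : Equiv.Perm (Fin m), (∀ p, β' (u p) = β' p) →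
      z * permCastLE h u ∈ X := by
    intro z hz u hu
    simp only [hXdef, Finset.mem_filter, Finset.mem_univ, true_and] at hz ⊢
    intro p
    have h1 := hz (d (permCastLE h u (d⁻¹ p)))
    rw [hβdu u hu, show d (d⁻¹ p) = p from d.apply_symm_apply p] at h1
    rw [← h1]
    simp
  have hlen : ∀ z ∈ X, permLength z = permLength d + permLength (z * d⁻¹) := by
    intro z hz
    simp only [hXdef, Finset.mem_filter, Finset.mem_univ, true_and] at hz
    rw [← permLength_mul _ _ (hxd _ hz), inv_mul_cancel_right]
  have hsum : T d * ∑ x ∈ Finset.univ.filter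
        (fun x : Equiv.Perm (Fin n) => ∀ p, β (x p) = β p), c ^ permLength x • T x
      = ∑ z ∈ X, c ^ permLength (z * d⁻¹) • T z := by
    rw [Finset.mul_sum]
    refine Finset.sum_bij (fun x _ => x * d) ?_ ?_ ?_ ?_
    · intro x hx
      simp only [hXdef, Finset.mem_filter, Finset.mem_univ, true_and] at hx ⊢
      rwa [mul_inv_cancel_right]
    · intro x _ y _ hxy
      exact mul_right_cancel hxy
    · intro z hz
      have hz' : z * d⁻¹ ∈ Finset.univ.filter
          (fun x : Equiv.Perm (Fin n) => ∀ p, β (x p) = β p) := by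
        simpa only [hXdef, Finset.mem_filter, Finset.mem_univ, true_and] using hz
      exact ⟨z * d⁻¹, hz', inv_mul_cancel_right _ _⟩
    · intro x hx
      simp only [Finset.mem_filter, Finset.mem_univ, true_and] at hx
      rw [mul_smul_comm, hT.mul_of_inversions _ _ (hxd x hx), mul_inv_cancel_right]
  refine ⟨∑ e ∈ X.filter (IncrOnBlocks h β'), c ^ permLength (e * d⁻¹) • T e, ?_⟩
  rw [hTw, mul_assoc, hsum, map_mul, mul_assoc, sum_eq_sum_incrOnBlocks h hβ' X hX,
    map_sum]
  congr 1
  rw [Finset.mul_sum]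
  refine Finset.sum_congr rfl fun e he => ?_
  rw [Finset.sum_mul]
  refine Finset.sum_congr rfl fun u hu => ?_
  simp only [Finset.mem_filter, Finset.mem_univ, true_and] at he hu
  have l1 := hlen _ (hX e he.1 u hu)
  have l2 := hlen _ he.1
  have l3 := he.2.permLength_mul hβ' hu
  have l4 : permLength (e * permCastLE h u * d⁻¹) = permLength u + permLength (e * d⁻¹) := by
    omega
  rw [l4, map_smul, map_heckeBasis h hT hT' g hg, smul_mul_smul_comm, ← pow_add,
    hT.mul_of_inversions _ _ (he.2.inversions hβ' hu)]

end Cosets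

section Diagram

lemma cumSum_mono (lam : ℕ → ℕ) : Monotone (cumSum lam) := fun _ _ h =>
  Finset.sum_le_sum_of_subset (Finset.range_mono h)

lemma cumSum_succ (lam : ℕ → ℕ) (r : ℕ) : cumSum lam (r + 1) = cumSum lam r + lam r :=
  Finset.sum_range_succ _ _

lemma rowOf_eq {lam : ℕ → ℕ} {p r : ℕ} (h1 : cumSum lam r ≤ p) (h2 : p < cumSum lam (r + 1)) :
    rowOf lam p = r := by
  refine le_antisymm (Nat.sInf_le h2) (le_csInf ⟨r, h2⟩ fun s hs => ?_)
  by_contra hlt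
  have := cumSum_mono lam (show s + 1 ≤ r by omega)
  have hs' : p < cumSum lam (s + 1) := hs
  omega

lemma rowOf_spec {lam : ℕ → ℕ} {p N : ℕ} (hp : p < cumSum lam N) :
    cumSum lam (rowOf lam p) ≤ p ∧ p < cumSum lam (rowOf lam p + 1) ∧ rowOf lam p < N := by
  obtain ⟨M, rfl⟩ : ∃ M, N = M + 1 := by
    cases N with
    | zero => simp [cumSum] at hp
    | succ M => exact ⟨M, rfl⟩
  have hmem : M ∈ {r | p < cumSum lam (r + 1)} := hp
  refine ⟨?_, Nat.sInf_mem ⟨M, hmem⟩, Nat.lt_succ_of_le (Nat.sInf_le hmem)⟩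
  rcases Nat.eq_zero_or_pos (rowOf lam p) with h0 | hpos
  · simp [h0, cumSum]
  · by_contra hlt
    have : rowOf lam p ≤ rowOf lam p - 1 :=
      Nat.sInf_le (show p < cumSum lam (rowOf lam p - 1 + 1) by
        rw [Nat.sub_add_cancel hpos]; omega)
    omega

lemma rowOf_add {lam : ℕ → ℕ} {r c : ℕ} (h : c < lam r) : rowOf lam (cumSum lam r + c) = r :=
  rowOf_eq (Nat.le_add_right _ _) (by rw [cumSum_succ]; omega)

lemma colIdx_add {lam : ℕ → ℕ} {r c : ℕ} (h : c < lam r) : colIdx lam (cumSum lam r + c) = c := by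
  rw [colIdx, rowOf_add h, Nat.add_sub_cancel_left]

lemma cumSum_add_colIdx {lam : ℕ → ℕ} {p N : ℕ} (hp : p < cumSum lam N) :
    cumSum lam (rowOf lam p) + colIdx lam p = p :=
  Nat.add_sub_cancel' (rowOf_spec hp).1

lemma colIdx_lt {lam : ℕ → ℕ} {p N : ℕ} (hp : p < cumSum lam N) :
    colIdx lam p < lam (rowOf lam p) := by
  have h1 := cumSum_add_colIdx hp
  have h2 := (rowOf_spec hp).2.1
  rw [cumSum_succ] at h2
  omega

lemma rowOf_mono {lam : ℕ → ℕ} {p p' N : ℕ} (hp' : p' < cumSum lam N) (h : p ≤ p') :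
    rowOf lam p ≤ rowOf lam p' :=
  Nat.sInf_le (h.trans_lt (rowOf_spec hp').2.1)

lemma lt_conjP {mu : ℕ → ℕ} (hmu : Antitone mu) {N : ℕ} (hN : mu N = 0) {r c : ℕ} :
    r < conjP mu c ↔ c < mu r := by
  have hne : {r | mu r ≤ c}.Nonempty := ⟨N, by simp [hN]⟩
  constructor
  · intro h
    by_contra hc
    exact absurd (Nat.sInf_le (show r ∈ {r | mu r ≤ c} from not_lt.1 hc)) (not_le.2 h)
  · intro h
    by_contra hc
    have h1 : mu (conjP mu c) ≤ c := Nat.sInf_mem hne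
    have h2 := hmu (not_lt.1 hc)
    omega

variable {n : ℕ} {mu : ℕ → ℕ} {N : ℕ}

lemma card_colIdx_eq (hmu : Antitone mu) (hN : mu N = 0) (hn : cumSum mu N = n) (c : ℕ) :
    (Finset.univ.filter (fun p : Fin n => colIdx mu (p : ℕ) = c)).card = conjP mu c := by
  rw [← Finset.card_range (conjP mu c)]
  refine Finset.card_bij (fun p _ => rowOf mu (p : ℕ)) ?_ ?_ ?_
  · intro p hp
    simp only [Finset.mem_filter, Finset.mem_univ, true_and] at hp
    rw [Finset.mem_range, lt_conjP hmu hN, ← hp]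
    exact colIdx_lt (p.isLt.trans_eq hn.symm)
  · intro p hp p' hp' h
    simp only [Finset.mem_filter, Finset.mem_univ, true_and] at hp hp'
    have h1 := cumSum_add_colIdx (lam := mu) (N := N) (p.isLt.trans_eq hn.symm)
    have h2 := cumSum_add_colIdx (lam := mu) (N := N) (p'.isLt.trans_eq hn.symm)
    rw [hp, h] at h1
    rw [hp'] at h2
    exact Fin.ext (h1.symm.trans h2)
  · intro r hr
    rw [Finset.mem_range, lt_conjP hmu hN] at hr
    have hrN : r < N := by
      by_contra hle
      have := hmu (not_lt.1 hle)
      omega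
    have hlt : cumSum mu r + c < n := by
      have h1 := cumSum_mono mu (show r + 1 ≤ N from hrN)
      rw [cumSum_succ] at h1
      omega
    exact ⟨⟨cumSum mu r + c, hlt⟩, by simp [colIdx_add hr], rowOf_add hr⟩

lemma card_colIdx_lt (hmu : Antitone mu) (hN : mu N = 0) (hn : cumSum mu N = n) (c : ℕ) :
    (Finset.univ.filter (fun p : Fin n => colIdx mu (p : ℕ) < c)).card
      = cumSum (conjP mu) c := by
  induction c with
  | zero => simp [cumSum]
  | succ c ih =>
    rw [cumSum_succ, ← ih, ← card_colIdx_eq hmu hN hn c, ← Finset.card_union_of_disjoint]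
    · congr 1
      ext p
      simp only [Finset.mem_filter, Finset.mem_univ, true_and, Finset.mem_union]
      omega
    · rw [Finset.disjoint_left]
      intro p h1 h2
      simp only [Finset.mem_filter, Finset.mem_univ, true_and] at h1 h2
      omega

lemma IsWmu.lt_of_lex {w : Equiv.Perm (Fin n)} (hw : IsWmu mu w) {p p' : Fin n}
    (h : colIdx mu (p : ℕ) < colIdx mu (p' : ℕ) ∨
      (colIdx mu (p : ℕ) = colIdx mu (p' : ℕ) ∧ rowOf mu (p : ℕ) < rowOf mu (p' : ℕ))) :
    w p < w p' := by
  rw [Fin.lt_def, hw p, hw p']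
  refine Finset.card_lt_card (Finset.ssubset_iff_of_subset ?_ |>.2 ⟨p, ?_, ?_⟩)
  · intro x hx
    simp only [Finset.mem_filter, Finset.mem_univ, true_and] at hx ⊢
    omega
  · simpa using h
  · simp

lemma IsWmu.lt_iff (hn : cumSum mu N = n) {w : Equiv.Perm (Fin n)} (hw : IsWmu mu w)
    {p p' : Fin n} : w p < w p' ↔ (colIdx mu (p : ℕ) < colIdx mu (p' : ℕ) ∨
      (colIdx mu (p : ℕ) = colIdx mu (p' : ℕ) ∧ rowOf mu (p : ℕ) < rowOf mu (p' : ℕ))) := by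
  refine ⟨fun h => ?_, hw.lt_of_lex⟩
  by_contra hcon
  by_cases heq : colIdx mu (p : ℕ) = colIdx mu (p' : ℕ) ∧ rowOf mu (p : ℕ) = rowOf mu (p' : ℕ)
  · have h1 := cumSum_add_colIdx (lam := mu) (N := N) (p.isLt.trans_eq hn.symm)
    have h2 := cumSum_add_colIdx (lam := mu) (N := N) (p'.isLt.trans_eq hn.symm)
    rw [heq.1, heq.2] at h1
    have : p = p' := Fin.ext (h1.symm.trans h2)
    simp [this] at h
  · exact absurd (hw.lt_of_lex (p := p') (p' := p) (by omega)) (not_lt.2 h.le)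

lemma IsWmu.conjP_bounds (hmu : Antitone mu) (hN : mu N = 0) (hn : cumSum mu N = n)
    {w : Equiv.Perm (Fin n)} (hw : IsWmu mu w) (p : Fin n) :
    cumSum (conjP mu) (colIdx mu (p : ℕ)) ≤ w p ∧
      (w p : ℕ) < cumSum (conjP mu) (colIdx mu (p : ℕ) + 1) := by
  rw [← card_colIdx_lt hmu hN hn, ← card_colIdx_lt hmu hN hn, hw p]
  constructor
  · refine Finset.card_le_card fun x hx => ?_
    simp only [Finset.mem_filter, Finset.mem_univ, true_and] at hx ⊢
    exact Or.inl hx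
  · refine Finset.card_lt_card (Finset.ssubset_iff_of_subset ?_ |>.2 ⟨p, ?_, ?_⟩)
    · intro x hx
      simp only [Finset.mem_filter, Finset.mem_univ, true_and] at hx ⊢
      omega
    · simp
    · simp

lemma IsWmu.rowOf_conjP (hmu : Antitone mu) (hN : mu N = 0) (hn : cumSum mu N = n)
    {w : Equiv.Perm (Fin n)} (hw : IsWmu mu w) (p : Fin n) :
    rowOf (conjP mu) (w p : ℕ) = colIdx mu (p : ℕ) :=
  rowOf_eq (hw.conjP_bounds hmu hN hn p).1 (hw.conjP_bounds hmu hN hn p).2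

lemma IsWmu.rowOf_conjP_monotone (hmu : Antitone mu) (hN : mu N = 0) (hn : cumSum mu N = n)
    {w : Equiv.Perm (Fin n)} (hw : IsWmu mu w) :
    Monotone (fun p : Fin n => rowOf (conjP mu) (p : ℕ)) := by
  intro p p' h
  obtain ⟨a, rfl⟩ := w.surjective p'
  exact rowOf_mono (hw.conjP_bounds hmu hN hn a).2 h

lemma IsWmu.rowOf_conjP_lt (hmu : Antitone mu) (hN : mu N = 0) (hn : cumSum mu N = n)
    {w : Equiv.Perm (Fin n)} (hw : IsWmu mu w) {i j : Fin n} (hij : i < j) (h : w j < w i) :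
    rowOf (conjP mu) (w j : ℕ) < rowOf (conjP mu) (w i : ℕ) := by
  rw [hw.rowOf_conjP hmu hN hn, hw.rowOf_conjP hmu hN hn]
  rcases (hw.lt_iff hn).1 h with h' | ⟨-, h'⟩
  · exact h'
  · have := rowOf_mono (lam := mu) (N := N) (j.isLt.trans_eq hn.symm) (Fin.le_def.1 hij.le)
    omega

end Diagram


/-- Proposition: `T_{w_μ} y_{μ'} ∈ Γ_0(T_{w_{μ̃}} y_{μ̃'}) H_n`.
`μ ⊢ n`, `L` the number of nonzero parts, `μ̃ = (μ_1,…,μ_{l-1}) ⊢ n - μ_l` obtained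
by removing the last row; `Γ_0 : H_{n-μ_l} → H_n` the standard embedding `T_i ↦ T_i`
(called `g` below). -/
theorem twy_bottom_row_removal
    {F : Type*} [Field F] {H : Type*} [Ring H] [Algebra F H]
    {H' : Type*} [Ring H'] [Algebra F H']
    {n : ℕ} (q : F) (hq : q ≠ 0)
    (mu : ℕ → ℕ) (hmu : IsPartition n mu)
    (L : ℕ) (hLpos : 0 < L) (hL : ∀ s, mu s = 0 ↔ L ≤ s)
    (T : Equiv.Perm (Fin n) → H) (hT : IsHeckeBasis q T)
    (T' : Equiv.Perm (Fin (n - mu (L-1))) → H') (hT' : IsHeckeBasis q T')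
    (g : H' →ₐ[F] H)
    (hg : ∀ (i : ℕ) (hi : i + 1 < n - mu (L-1)),
      g (T' (adjT i hi)) = T (adjT i (by omega)))
    (wmu : Equiv.Perm (Fin n)) (hwmu : IsWmu mu wmu)
    (wmut : Equiv.Perm (Fin (n - mu (L-1))))
    (hwmut : IsWmu (fun s => if s + 1 < L then mu s else 0) wmut) :
    ∃ h : H, T wmu * yElt q T (conjP mu)
      = g (T' wmut * yElt q T' (conjP (fun s => if s + 1 < L then mu s else 0))) * h := by
  have hanti : Antitone mu := hmu.2
  have hLz : mu L = 0 := (hL L).2 le_rfl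
  have hcum : cumSum mu L = n := by
    obtain ⟨N, hN, hn⟩ := hmu.1
    rw [← hn]
    exact Finset.sum_subset (Finset.range_mono ((hL N).1 (hN N le_rfl)))
      fun r _ hr => (hL r).2 (by simpa using hr)
  obtain ⟨M, rfl⟩ : ∃ M, L = M + 1 := ⟨L - 1, by omega⟩
  simp only [Nat.add_sub_cancel] at *
  set nu : ℕ → ℕ := fun s => if s + 1 < M + 1 then mu s else 0 with hnu
  have hnu_lt : ∀ s, s < M → nu s = mu s := fun s hs => if_pos (by omega)
  have hnu_ge : ∀ s, M ≤ s → nu s = 0 := fun s hs => if_neg (by omega)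
  have hnu_anti : Antitone nu := by
    intro a b hab
    rcases lt_or_ge b M with hb | hb
    · rw [hnu_lt b hb, hnu_lt a (by omega)]
      exact hanti hab
    · rw [hnu_ge b hb]
      exact Nat.zero_le _
  have hnu_cum : ∀ r, r ≤ M → cumSum nu r = cumSum mu r := fun r hr =>
    Finset.sum_congr rfl fun s hs => hnu_lt s (by rw [Finset.mem_range] at hs; omega)
  have hnM : cumSum nu M = n - mu M := by
    rw [hnu_cum M le_rfl, ← hcum, cumSum_succ, Nat.add_sub_cancel]
  have hnuz : nu M = 0 := hnu_ge M le_rfl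
  have hrow : ∀ p, p < n - mu M → rowOf mu p = rowOf nu p := by
    intro p hp
    obtain ⟨h1, h2, h3⟩ := rowOf_spec (hp.trans_eq hnM.symm)
    rw [hnu_cum _ (by omega)] at h1 h2
    exact rowOf_eq h1 h2
  have hcol : ∀ p, p < n - mu M → colIdx mu p = colIdx nu p := by
    intro p hp
    have h3 := (rowOf_spec (hp.trans_eq hnM.symm)).2.2
    rw [colIdx, colIdx, hrow p hp, hnu_cum _ (by omega)]
  unfold yElt youngW
  simp only [Set.mem_ofPred_eq]
  refine exists_factor_of_blocks (-q)⁻¹ (Nat.sub_le n (mu M)) hT hT' g hg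
    (hwmu.rowOf_conjP_monotone hanti hLz hcum)
    (hwmut.rowOf_conjP_monotone hnu_anti hnuz hnM) wmu wmut ?_
    (fun i j hij h => hwmu.rowOf_conjP_lt hanti hLz hcum hij h) ?_
  · intro a b hab
    rw [hwmut.lt_iff hnM] at hab
    rw [hwmu.lt_iff hcum]
    simpa only [Fin.val_castLE, hrow _ a.isLt, hrow _ b.isLt, hcol _ a.isLt, hcol _ b.isLt]
      using hab
  · intro a
    rw [hwmu.rowOf_conjP hanti hLz hcum, hwmut.rowOf_conjP hnu_anti hnuz hnM]
    exact hcol _ a.isLt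

end FayersSemistd
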